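/- arXiv:1910.10873 — 2 statements merged into one kernel-verified Lean document; each statement's English description precedes it below -/
import Mathlib

section
/- For all integers T ≥ K ≥ 1, the minimax regret of one-dimensional switching-constrained online linear optimization satisfies R₁(T,K) ≥ T/√(2K). -/
/-- The increment in the number of switches when the player, whose previous action is
`last` (`none` at the first round), plays `x`. -/
noncomputable def switchInc (last : Option ℝ) (x : ℝ) : ℕ :=
  match last with
  | none => 0
  | some y => if x = y then 0 else 1

/-- Backward-recursive value of the one-dimensional switching-constrained online linear
optimization game: `gameVal1 K t last s W` is the value of the game with `t` rounds
remaining, previous player action `last`, `s` switches used so far, and accumulated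
adversary sum `W`.  The player's infimum ranges only over actions in `[-1,1]` keeping
the total number of switches strictly below `K` (equivalently, the payoff is `+∞` as soon
as `K` switches are reached), the adversary's supremum ranges over `[-1,1]`, and at the
end the comparator term `|∑ wᵢ|` is added. -/
noncomputable def gameVal1 (K : ℕ) : ℕ → Option ℝ → ℕ → ℝ → ℝ
  | 0, _, _, W => |W|
  | t + 1, last, s, W =>
      sInf ((fun x : ℝ =>
        sSup ((fun w : ℝ => w * x + gameVal1 K t (some x) (s + switchInc last x) (W + w)) ''
          Set.Icc (-1 : ℝ) 1)) ''
        {x : ℝ | x ∈ Set.Icc (-1 : ℝ) 1 ∧ s + switchInc last x < K})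

/-- `R₁(T,K)`: the minimax regret of `T`-round one-dimensional switching-constrained
online linear optimization with fewer than `K` switches. -/
noncomputable def R1 (T K : ℕ) : ℝ := gameVal1 K T none 0 0

/-- The Huber function with threshold `a`: quadratic on `[-a, a]`, the absolute value elsewhere. -/
noncomputable def huber (a W : ℝ) : ℝ :=
  if |W| ≤ a then (a ^ 2 + W ^ 2) / (2 * a) else |W|

lemma huber_zero_left (W : ℝ) : huber 0 W = |W| := by
  unfold huber
  split_ifs with h
  · simp [abs_nonpos_iff.mp h]
  · rfl

/-- The affine minorants of the Huber function. -/
lemma affine_le_huber {a W p : ℝ} (ha : 0 ≤ a) (hp : |p| ≤ 1) :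
    p * W + (1 - p ^ 2) * a / 2 ≤ huber a W := by
  have hp2 : 0 ≤ 1 - p ^ 2 := by nlinarith [sq_abs p, abs_nonneg p]
  unfold huber
  split_ifs with h
  · rcases ha.eq_or_lt with rfl | ha
    · simp [abs_nonpos_iff.mp h]
    · rw [le_div_iff₀ (by positivity)]
      nlinarith [sq_nonneg (W - p * a)]
  · push Not at h
    have h1 : p * W ≤ |p| * |W| := by rw [← abs_mul]; exact le_abs_self _
    have h2 : (1 - p ^ 2) * a ≤ (1 - p ^ 2) * |W| := mul_le_mul_of_nonneg_left h.le hp2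
    rw [← sq_abs p] at h2 ⊢
    nlinarith [mul_nonneg (abs_nonneg W) (sq_nonneg (1 - |p|))]

lemma le_huber {a W : ℝ} (ha : 0 ≤ a) : W ≤ huber a W := by
  simpa using affine_le_huber (W := W) ha (p := 1) (by simp)

lemma neg_le_huber {a W : ℝ} (ha : 0 ≤ a) : -W ≤ huber a W := by
  simpa using affine_le_huber (W := W) ha (p := -1) (by simp)

/-- The quadratic inequality behind one step of the potential; by convexity in `ω ^ 2` it follows
from the cases `ω = 0` and `ω = a`. -/
lemma huber_step_discriminant {a b ω : ℝ} (ha : 0 < a) (ha1 : a ≤ 1) (hb : 0 < b)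
    (hab : b ^ 2 * (2 - a ^ 2) = 2 * a ^ 2) (hω : ω ^ 2 ≤ a ^ 2) :
    (1 + b * ((a ^ 2 + ω ^ 2) / (2 * a)) - ω ^ 2) ^ 2 ≤ 1 + b ^ 2 - ω ^ 2 := by
  obtain ⟨ρ, rfl⟩ : ∃ ρ, b = ρ * a := ⟨b / a, by field_simp⟩
  have hρ : 0 < ρ := pos_of_mul_pos_left hb ha.le
  have ha2 : a ^ 2 ≤ 1 := by nlinarith
  have hab' : ρ ^ 2 * (2 - a ^ 2) = 2 :=
    mul_right_cancel₀ (pow_pos ha 2).ne' (by linear_combination hab)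
  have hη : ρ * a * ((a ^ 2 + ω ^ 2) / (2 * a)) = ρ * (a ^ 2 + ω ^ 2) / 2 := by
    field_simp
  rw [hη, mul_pow]
  have hs0 : 0 ≤ ω ^ 2 := sq_nonneg ω
  have hA : 0 < a ^ 2 := pow_pos ha 2
  generalize ω ^ 2 = s at *
  generalize a ^ 2 = A at *
  have hρ1 : 1 ≤ ρ := by nlinarith
  have h0 : (1 + ρ * A / 2) ^ 2 ≤ 1 + ρ ^ 2 * A := by
    have h : 1 ≤ ρ * (1 - A / 4) := by
      refine le_of_sq_le_sq ?_ (by nlinarith)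
      nlinarith [mul_nonneg (sq_nonneg ρ) (sq_nonneg A)]
    nlinarith [mul_le_mul_of_nonneg_left h (mul_pos hρ hA).le]
  have h1 : (1 + (ρ - 1) * A) ^ 2 ≤ 1 + (ρ ^ 2 - 1) * A := by
    nlinarith [mul_nonneg (mul_nonneg (sq_nonneg (ρ - 1)) hA.le) (sub_nonneg.mpr ha2)]
  refine le_of_mul_le_mul_left ?_ hA
  have h2 := mul_le_mul_of_nonneg_left h0 (sub_nonneg.mpr hω)
  have h3 := mul_le_mul_of_nonneg_left h1 hs0
  have h4 : 0 ≤ (ρ / 2 - 1) ^ 2 * A * (s * (A - s)) := by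
    have := sub_nonneg.mpr hω
    positivity
  linear_combination h2 + h3 + h4

lemma exists_huber_slope {a b t W : ℝ} (ha : 0 < a) (ha1 : a ≤ 1) (hb : 0 < b)
    (hab : b ^ 2 * (2 - a ^ 2) = 2 * a ^ 2) (ht : 0 < t) :
    ∃ l : ℝ, ∀ m, 0 ≤ m → m ≤ t →
      huber (t * a) W + l * m ≤ huber ((t - m) * b) (W + m) ∧
      huber (t * a) W - l * m ≤ huber ((t - m) * b) (W - m) := by
  by_cases hW : |W| ≤ t * a
  · obtain ⟨ω, rfl⟩ : ∃ ω, W = t * ω := ⟨W / t, by field_simp⟩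
    have hωa : |ω| ≤ a := by
      rw [abs_mul, abs_of_pos ht] at hW
      exact le_of_mul_le_mul_left hW ht
    have hω2 : ω ^ 2 ≤ a ^ 2 := sq_le_sq' (abs_le.mp hωa).1 (abs_le.mp hωa).2
    have hH : huber (t * a) (t * ω) = t * ((a ^ 2 + ω ^ 2) / (2 * a)) := by
      rw [huber, if_pos hW]; field_simp
    have hdisc := huber_step_discriminant ha ha1 hb hab hω2
    have hηω : |ω| ≤ (a ^ 2 + ω ^ 2) / (2 * a) := by
      rw [le_div_iff₀ (by positivity), ← sq_abs ω]
      nlinarith [sq_nonneg (a - |ω|)]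
    rw [hH]
    generalize (a ^ 2 + ω ^ 2) / (2 * a) = η at *
    have hab_le : a ≤ b := by
      have : a ^ 2 ≤ b ^ 2 := by nlinarith [sq_nonneg (a * b)]
      exact le_of_sq_le_sq this hb.le
    obtain ⟨h1, h2⟩ := abs_le.mp hωa
    obtain ⟨h3, h4⟩ := abs_le.mp hηω
    have hD : (b * η - ω ^ 2) ^ 2 ≤ ω ^ 2 - 2 * b * η + b ^ 2 := by linarith
    have hΔ : b * η - ω ^ 2 ≤ √(ω ^ 2 - 2 * b * η + b ^ 2) := Real.le_sqrt_of_sq_le hD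
    have hΔ0 := Real.sqrt_nonneg (ω ^ 2 - 2 * b * η + b ^ 2)
    have hΔsq := Real.sq_sqrt ((sq_nonneg _).trans hD)
    generalize √(ω ^ 2 - 2 * b * η + b ^ 2) = Δ at *
    have hΔ1 : Δ ≤ b - ω := abs_le_of_sq_le_sq' (by nlinarith) (by linarith) |>.2
    have hΔ2 : Δ ≤ b + ω := abs_le_of_sq_le_sq' (by nlinarith) (by linarith) |>.2
    obtain ⟨p, hp⟩ : ∃ p, p * b = ω + Δ := ⟨(ω + Δ) / b, by field_simp⟩
    obtain ⟨q, hq⟩ : ∃ q, q * b = ω - Δ := ⟨(ω - Δ) / b, by field_simp⟩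
    have hp1 : |p| ≤ 1 := abs_le.mpr ⟨by nlinarith, by nlinarith⟩
    have hq1 : |q| ≤ 1 := abs_le.mpr ⟨by nlinarith, by nlinarith⟩
    have hpη : p * ω + (1 - p ^ 2) * b / 2 = η := by
      apply mul_right_cancel₀ hb.ne'
      linear_combination (ω - (p * b + ω + Δ) / 2) * hp - hΔsq / 2
    have hqη : q * ω + (1 - q ^ 2) * b / 2 = η := by
      apply mul_right_cancel₀ hb.ne'
      linear_combination (ω - (q * b + ω - Δ) / 2) * hq - hΔsq / 2
    have hpq : q + (1 - q ^ 2) * b / 2 ≤ p - (1 - p ^ 2) * b / 2 := by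
      have : 0 ≤ (p - q + ω * (p + q) - 2 * η) * b := by nlinarith
      have := nonneg_of_mul_nonneg_left this hb
      linarith
    refine ⟨p - (1 - p ^ 2) * b / 2, fun m hm hmt => ?_⟩
    have hc : 0 ≤ (t - m) * b := mul_nonneg (by linarith) hb.le
    constructor
    · refine le_trans (le_of_eq ?_) (affine_le_huber hc hp1)
      linear_combination -t * hpη
    · refine le_trans ?_ (affine_le_huber hc hq1)
      have := mul_le_mul_of_nonneg_right hpq hm
      linear_combination this - t * hqη
  · rw [huber, if_neg hW]
    rcases abs_cases W with ⟨h, -⟩ | ⟨h, -⟩ <;> rw [h]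
    · refine ⟨1, fun m _ hmt => ?_⟩
      have hc : 0 ≤ (t - m) * b := mul_nonneg (by linarith) hb.le
      constructor <;> refine le_trans (le_of_eq ?_) (le_huber hc) <;> ring
    · refine ⟨-1, fun m _ hmt => ?_⟩
      have hc : 0 ≤ (t - m) * b := mul_nonneg (by linarith) hb.le
      constructor <;> refine le_trans (le_of_eq ?_) (neg_le_huber hc) <;> ring

/-- A lower bound for the value of the game with `t` rounds remaining and adversary sum `W`, when
the player is about to start the first of at most `k` constant blocks. -/
noncomputable def regretPotential : ℕ → ℝ → ℝ → ℝ
  | 0, _, W => |W|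
  | 1, t, W => max |W| t
  | k + 2, t, W => huber (t * √(2 / (k + 2))) W

lemma regretPotential_zero_time (k : ℕ) (W : ℝ) : regretPotential k 0 W = |W| := by
  match k with
  | 0 => rfl
  | 1 => simp [regretPotential]
  | k + 2 => simp [regretPotential, huber_zero_left]

lemma exists_regretPotential_slope (k : ℕ) {t : ℝ} (W : ℝ) (ht : 0 < t) :
    ∃ l : ℝ, ∀ m, 0 ≤ m → m ≤ t →
      regretPotential (k + 2) t W + l * m ≤ regretPotential (k + 1) (t - m) (W + m) ∧
      regretPotential (k + 2) t W - l * m ≤ regretPotential (k + 1) (t - m) (W - m) := by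
  match k with
  | 0 =>
    by_cases hW : |W| ≤ t
    · obtain ⟨ω, rfl⟩ : ∃ ω, W = t * ω := ⟨W / t, by field_simp⟩
      have hω : |ω| ≤ 1 := by
        rw [abs_mul, abs_of_pos ht] at hW
        exact le_of_mul_le_mul_left (by simpa using hW) ht
      obtain ⟨h1, h2⟩ := abs_le.mp hω
      have hH : regretPotential 2 t (t * ω) = t * (1 + ω ^ 2) / 2 := by
        simp only [regretPotential]
        norm_num
        rw [huber, if_pos hW]
        field_simp
      refine ⟨ω, fun m hm hmt => ?_⟩
      rw [zero_add, hH]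
      simp only [regretPotential]
      constructor
      · have hl := (le_abs_self _).trans (le_max_left |t * ω + m| (t - m))
        have hr := le_max_right |t * ω + m| (t - m)
        nlinarith [mul_le_mul_of_nonneg_left hl (by linarith : 0 ≤ 1 + ω),
          mul_le_mul_of_nonneg_left hr (by linarith : 0 ≤ 1 - ω)]
      · have hl := (neg_le_abs _).trans (le_max_left |t * ω - m| (t - m))
        have hr := le_max_right |t * ω - m| (t - m)
        nlinarith [mul_le_mul_of_nonneg_left hl (by linarith : 0 ≤ 1 - ω),
          mul_le_mul_of_nonneg_left hr (by linarith : 0 ≤ 1 + ω)]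
    · have hH : regretPotential 2 t W = |W| := by
        simp only [regretPotential]
        norm_num
        rw [huber, if_neg hW]
      rw [zero_add, hH]
      simp only [regretPotential]
      rcases abs_cases W with ⟨h, -⟩ | ⟨h, -⟩ <;> rw [h]
      · refine ⟨1, fun m _ _ => ⟨?_, ?_⟩⟩ <;>
          refine le_trans (le_of_eq ?_) ((le_abs_self _).trans (le_max_left _ _)) <;> ring
      · refine ⟨-1, fun m _ _ => ⟨?_, ?_⟩⟩ <;>
          refine le_trans (le_of_eq ?_) ((neg_le_abs _).trans (le_max_left _ _)) <;> ring
  | k + 1 =>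
    have hk : (0 : ℝ) ≤ k := k.cast_nonneg
    simp only [regretPotential]
    refine exists_huber_slope (by positivity) ?_ (by positivity) ?_ ht
    · rw [Real.sqrt_le_one, div_le_one (by positivity)]
      push_cast; linarith
    · rw [Real.sq_sqrt (by positivity), Real.sq_sqrt (by positivity)]
      push_cast
      field_simp
      ring

/-- Against the player's action `x` the adversary has a sign which, kept for the whole block,
preserves the potential whenever the player ends the block. -/
lemma exists_sign_regretPotential_le (k : ℕ) {t x : ℝ} (W : ℝ) (ht : 0 < t) :
    ∃ σ : ℝ, (σ = 1 ∨ σ = -1) ∧ ∀ m, 0 ≤ m → m ≤ t → (m < t → 0 < k) →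
      regretPotential (k + 1) t W ≤ σ * m * x + regretPotential k (t - m) (W + σ * m) := by
  match k with
  | 0 =>
    have main : regretPotential 1 t W ≤ t * x + |W + t| ∨
        regretPotential 1 t W ≤ -t * x + |W - t| := by
      by_contra! h
      have h1 := abs_add_le (W + t) (W - t)
      have h2 := abs_sub (W + t) (W - t)
      have e1 : |W + t + (W - t)| = 2 * |W| := by
        rw [show W + t + (W - t) = 2 * W by ring, abs_mul]; norm_num
      have e2 : |W + t - (W - t)| = 2 * t := by
        rw [show W + t - (W - t) = 2 * t by ring, abs_of_pos (by linarith)]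
      simp only [regretPotential] at h
      rcases max_cases |W| t with ⟨e, -⟩ | ⟨e, -⟩ <;> rw [e] at h <;> linarith [h.1, h.2]
    rcases main with h | h
    · refine ⟨1, Or.inl rfl, fun m _ hmt hm => ?_⟩
      obtain rfl : m = t := hmt.eq_of_not_lt fun hlt => absurd (hm hlt) (lt_irrefl _)
      simpa [regretPotential] using h
    · refine ⟨-1, Or.inr rfl, fun m _ hmt hm => ?_⟩
      obtain rfl : m = t := hmt.eq_of_not_lt fun hlt => absurd (hm hlt) (lt_irrefl _)
      simpa [regretPotential, sub_eq_add_neg] using h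
  | k + 1 =>
    obtain ⟨l, hl⟩ := exists_regretPotential_slope k W ht
    rcases le_total 0 (l + x) with h | h
    · refine ⟨1, Or.inl rfl, fun m hm hmt _ => ?_⟩
      rw [one_mul]
      nlinarith [(hl m hm hmt).1]
    · refine ⟨-1, Or.inr rfl, fun m hm hmt _ => ?_⟩
      have := (hl m hm hmt).2
      rw [neg_one_mul, ← sub_eq_add_neg]
      nlinarith

lemma div_sqrt_le_regretPotential {k : ℕ} (hk : 1 ≤ k) {t : ℝ} (ht : 0 ≤ t) :
    t / √(2 * k) ≤ regretPotential k t 0 := by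
  match k, hk with
  | 1, _ =>
    simp only [regretPotential]
    refine (div_le_self ht ?_).trans (le_max_right _ _)
    rw [Real.one_le_sqrt]; norm_num
  | k + 2, _ =>
    simp only [regretPotential]
    refine le_trans (le_of_eq ?_)
      (affine_le_huber (W := 0) (p := 0) (by positivity) (by simp))
    push_cast
    have hk : (0 : ℝ) < k + 2 := by positivity
    rw [Real.sqrt_mul (by norm_num), Real.sqrt_div (by norm_num)]
    have := Real.sq_sqrt (show (0 : ℝ) ≤ 2 by norm_num)
    field_simp
    linear_combination (-t) * this

lemma abs_sSup_le {S : Set ℝ} {C : ℝ} (hC : 0 ≤ C) (h : ∀ x ∈ S, |x| ≤ C) : |sSup S| ≤ C := by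
  refine abs_le.mpr ⟨?_, Real.sSup_le (fun x hx => (abs_le.mp (h x hx)).2) hC⟩
  rcases S.eq_empty_or_nonempty with rfl | ⟨x, hx⟩
  · simpa using hC
  · exact (abs_le.mp (h x hx)).1.trans (le_csSup ⟨C, fun y hy => (abs_le.mp (h y hy)).2⟩ hx)

lemma abs_sInf_le {S : Set ℝ} {C : ℝ} (hC : 0 ≤ C) (h : ∀ x ∈ S, |x| ≤ C) : |sInf S| ≤ C := by
  rw [Real.sInf_def, abs_neg]
  exact abs_sSup_le hC fun x hx => by simpa using h (-x) hx

lemma abs_gameVal1_le (K t : ℕ) (last : Option ℝ) (s : ℕ) (W : ℝ) :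
    |gameVal1 K t last s W| ≤ |W| + 2 * t := by
  induction t generalizing last s W with
  | zero => simp [gameVal1]
  | succ t ih =>
    have hC : 0 ≤ |W| + 2 * ((t + 1 : ℕ) : ℝ) := by positivity
    refine abs_sInf_le hC ?_
    rintro _ ⟨x, ⟨hx, -⟩, rfl⟩
    refine abs_sSup_le hC ?_
    rintro _ ⟨w, hw, rfl⟩
    have h1 : |w| ≤ 1 := abs_le.mpr hw
    have h2 : |w * x| ≤ 1 := by
      rw [abs_mul]
      exact mul_le_one₀ h1 (abs_nonneg x) (abs_le.mpr hx)
    have h3 := abs_add_le (w * x) (gameVal1 K t (some x) (s + switchInc last x) (W + w))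
    have h4 := ih (some x) (s + switchInc last x) (W + w)
    have h5 := abs_add_le W w
    push_cast
    linarith

lemma le_sSup_gameVal1 (K t s : ℕ) (W : ℝ) {x w : ℝ} (hx : x ∈ Set.Icc (-1 : ℝ) 1)
    (hw : w ∈ Set.Icc (-1 : ℝ) 1) :
    w * x + gameVal1 K t (some x) s (W + w) ≤
      sSup ((fun w : ℝ => w * x + gameVal1 K t (some x) s (W + w)) '' Set.Icc (-1 : ℝ) 1) := by
  refine le_csSup ⟨1 + (|W| + 1 + 2 * t), ?_⟩ ⟨w, hw, rfl⟩
  rintro _ ⟨v, hv, rfl⟩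
  have h1 : |v| ≤ 1 := abs_le.mpr hv
  have h2 : |v * x| ≤ 1 := by
    rw [abs_mul]
    exact mul_le_one₀ h1 (abs_nonneg x) (abs_le.mpr hx)
  have h3 := (le_abs_self _).trans (abs_gameVal1_le K t (some x) s (W + v))
  have h4 := abs_add_le W v
  have h5 := le_abs_self (v * x)
  linarith

/-- The value during a block, when the adversary keeps playing the sign `σ` until the player
switches: `m` is the number of further rounds before the switch (or the end of the game). -/
def BlockBound (K t : ℕ) : Prop :=
  ∀ (y : ℝ) (s : ℕ) (W σ C : ℝ), y ∈ Set.Icc (-1 : ℝ) 1 → (σ = 1 ∨ σ = -1) → s < K →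
    (∀ m : ℕ, m ≤ t → (m < t → s + 1 < K) →
      C ≤ σ * m * y + regretPotential (K - 1 - s) (t - m) (W + σ * m)) →
    C ≤ gameVal1 K t (some y) s W

lemma BlockBound.regretPotential_le_sSup {K t : ℕ} (h : BlockBound K t) {s : ℕ} (hs : s < K)
    (W : ℝ) {x : ℝ} (hx : x ∈ Set.Icc (-1 : ℝ) 1) :
    regretPotential (K - s) (t + 1) W ≤
      sSup ((fun w : ℝ => w * x + gameVal1 K t (some x) s (W + w)) '' Set.Icc (-1 : ℝ) 1) := by
  obtain ⟨σ, hσ, hle⟩ :=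
    exists_sign_regretPotential_le (K - 1 - s) (x := x) W (Nat.cast_add_one_pos (α := ℝ) t)
  rw [show K - 1 - s + 1 = K - s by omega] at hle
  have hσ' : σ ∈ Set.Icc (-1 : ℝ) 1 := by rcases hσ with rfl | rfl <;> norm_num
  refine le_trans ?_ (le_sSup_gameVal1 K t s W hx hσ')
  rw [← sub_le_iff_le_add']
  refine h x s (W + σ) σ _ hx hσ hs fun m hm hmt => ?_
  have hm' : (m : ℝ) ≤ t := by exact_mod_cast hm
  have := hle (m + 1) (by positivity) (by linarith) fun hlt => by
    have : m < t := by exact_mod_cast (add_lt_add_iff_right (1 : ℝ)).mp hlt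
    have := hmt this
    omega
  rw [show (t : ℝ) + 1 - (m + 1) = t - m by ring, show W + σ * (m + 1) = W + σ + σ * m by ring]
    at this
  linarith

lemma blockBound (K t : ℕ) : BlockBound K t := by
  induction t with
  | zero =>
    intro y s W σ C _ _ _ hC
    have := hC 0 le_rfl (fun h => absurd h (lt_irrefl _))
    simpa [gameVal1, regretPotential_zero_time] using this
  | succ t ih =>
    intro y s W σ C hy hσ hs hC
    refine le_csInf ⟨_, y, ⟨hy, by simpa [switchInc] using hs⟩, rfl⟩ ?_
    rintro _ ⟨x, ⟨hx, hxs⟩, rfl⟩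
    by_cases hxy : x = y
    · subst hxy
      have hσ' : σ ∈ Set.Icc (-1 : ℝ) 1 := by rcases hσ with rfl | rfl <;> norm_num
      simp only [switchInc, if_true, add_zero]
      refine le_trans ?_ (le_sSup_gameVal1 K t s W hx hσ')
      rw [← sub_le_iff_le_add']
      refine ih x s (W + σ) σ _ hx hσ hs fun m hm hmt => ?_
      have := hC (m + 1) (by omega) (fun _ => hmt (by omega))
      push_cast at this
      rw [show (t : ℝ) + 1 - (m + 1) = t - m by ring,
        show W + σ * (m + 1) = W + σ + σ * m by ring] at this
      linarith
    · simp only [switchInc, if_neg hxy] at hxs ⊢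
      have := hC 0 (by omega) (fun _ => hxs)
      refine le_trans ?_ (ih.regretPotential_le_sSup hxs W hx)
      rw [show K - (s + 1) = K - 1 - s by omega]
      simpa using this

/-- For all integers `T ≥ K ≥ 1`, the minimax regret of one-dimensional
switching-constrained online linear optimization satisfies `R₁(T,K) ≥ T/√(2K)`. -/
theorem stmt0 (T K : ℕ) (hK : 1 ≤ K) (hTK : K ≤ T) :
    (T : ℝ) / Real.sqrt (2 * K) ≤ R1 T K := by
  obtain ⟨t, rfl⟩ : ∃ t, T = t + 1 := ⟨T - 1, by omega⟩
  refine (div_sqrt_le_regretPotential hK (Nat.cast_nonneg _)).trans ?_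
  refine le_csInf ⟨_, 0, ⟨by norm_num, by simp [switchInc]; omega⟩, rfl⟩ ?_
  rintro _ ⟨x, ⟨hx, -⟩, rfl⟩
  simpa [switchInc] using (blockBound K t).regretPotential_le_sSup (s := 0) hK 0 hx
end

section
/- For all integers T ≥ K ≥ 1, the minimax regret of one-dimensional switching-constrained online linear optimization satisfies R₁(T,K) ≤ ⌈T/K⌉ · min{√(2(K+1)/π), √K} ≤ 2√(2/π) · T/√K. -/
theorem gameVal1_nonneg (K t : ℕ) (last : Option ℝ) (s : ℕ) (W : ℝ) :
    0 ≤ gameVal1 K t last s W := by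
  induction t generalizing last s W with
  | zero => simp [gameVal1]
  | succ t ih =>
    rw [gameVal1]
    apply Real.sInf_nonneg
    rintro _ ⟨x, -, rfl⟩
    apply Real.sSup_nonneg'
    exact ⟨_, ⟨0, by simp, rfl⟩, by simpa using ih _ _ _⟩

/-- A single admissible action of the player bounds the value of the game from above. -/
theorem gameVal1_succ_le {K t s : ℕ} {last : Option ℝ} {W c : ℝ} (x : ℝ)
    (hx : x ∈ Set.Icc (-1 : ℝ) 1) (hs : s + switchInc last x < K)
    (h : ∀ w ∈ Set.Icc (-1 : ℝ) 1,
      w * x + gameVal1 K t (some x) (s + switchInc last x) (W + w) ≤ c) :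
    gameVal1 K (t + 1) last s W ≤ c := by
  rw [gameVal1]
  refine (csInf_le ⟨0, ?_⟩ (Set.mem_image_of_mem _ (Set.mem_ofPred.2 ⟨hx, hs⟩))).trans
    (csSup_le ((Set.nonempty_Icc.2 (by norm_num)).image _) ?_)
  · rintro _ ⟨y, -, rfl⟩
    apply Real.sSup_nonneg'
    exact ⟨_, ⟨0, by simp, rfl⟩, by simpa using gameVal1_nonneg _ _ _ _ _⟩
  · rintro _ ⟨w, hw, rfl⟩
    exact h w hw

/-- The expectation of `|W + M * S|`, where `S` is a sum of `k` independent random signs. -/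
noncomputable def absWalk (M : ℝ) : ℕ → ℝ → ℝ
  | 0, W => |W|
  | k + 1, W => (absWalk M k (W + M) + absWalk M k (W - M)) / 2

theorem convexOn_absWalk (M : ℝ) (k : ℕ) : ConvexOn ℝ Set.univ (absWalk M k) := by
  induction k with
  | zero => exact convexOn_univ_norm
  | succ k ih =>
    refine ⟨convex_univ, fun x _ y _ a b ha hb hab => ?_⟩
    have h₁ := ih.2 (Set.mem_univ (x + M)) (Set.mem_univ (y + M)) ha hb hab
    have h₂ := ih.2 (Set.mem_univ (x - M)) (Set.mem_univ (y - M)) ha hb hab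
    simp only [smul_eq_mul, absWalk] at *
    rw [show a * (x + M) + b * (y + M) = a * x + b * y + M by linear_combination M * hab] at h₁
    rw [show a * (x - M) + b * (y - M) = a * x + b * y - M by linear_combination -M * hab] at h₂
    linarith

theorem abs_absWalk_sub_le (M : ℝ) (k : ℕ) (x y : ℝ) :
    |absWalk M k x - absWalk M k y| ≤ |x - y| := by
  induction k generalizing x y with
  | zero => exact abs_abs_sub_abs_le_abs_sub x y
  | succ k ih =>
    have h₁ := abs_le.1 (ih (x + M) (y + M))
    have h₂ := abs_le.1 (ih (x - M) (y - M))
    rw [add_sub_add_right_eq_sub] at h₁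
    rw [sub_sub_sub_cancel_right] at h₂
    simp only [absWalk]
    rw [abs_le]
    constructor <;> linarith [h₁.1, h₁.2, h₂.1, h₂.2]

theorem abs_le_absWalk (M : ℝ) (k : ℕ) (W : ℝ) : |W| ≤ absWalk M k W := by
  induction k generalizing W with
  | zero => exact le_rfl
  | succ k ih =>
    have h₁ := ih (W + M)
    have h₂ := ih (W - M)
    have h₃ := abs_add_le (W + M) (W - M)
    rw [show W + M + (W - M) = 2 * W by ring, abs_mul, abs_two] at h₃
    simp only [absWalk]
    linarith

/-- The action that makes the adversary indifferent between the sums `-M` and `M` over a block. -/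
theorem exists_action_absWalk {M : ℝ} (hM : 0 < M) (k : ℕ) (W : ℝ) :
    ∃ x ∈ Set.Icc (-1 : ℝ) 1, ∀ v : ℝ, |v| ≤ M →
      v * x + absWalk M k (W + v) ≤ absWalk M (k + 1) W := by
  have hlip := abs_absWalk_sub_le M k (W - M) (W + M)
  rw [show W - M - (W + M) = -(2 * M) by ring, abs_neg,
    abs_of_pos (by positivity : 0 < 2 * M)] at hlip
  refine ⟨(absWalk M k (W - M) - absWalk M k (W + M)) / (2 * M), ?_, fun v hv => ?_⟩
  · rwa [Set.mem_Icc, ← abs_le, abs_div, abs_of_pos (by positivity : 0 < 2 * M), div_le_one (by positivity)]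
  · obtain ⟨hv₁, hv₂⟩ := abs_le.1 hv
    have h := (convexOn_absWalk M k).2 (Set.mem_univ (W + M)) (Set.mem_univ (W - M))
      (div_nonneg (by linarith) (by positivity) : 0 ≤ (M + v) / (2 * M))
      (div_nonneg (by linarith) (by positivity) : 0 ≤ (M - v) / (2 * M))
      (by field_simp; ring)
    simp only [smul_eq_mul] at h
    rw [show (M + v) / (2 * M) * (W + M) + (M - v) / (2 * M) * (W - M) = W + v by
      field_simp; ring] at h
    simp only [absWalk]
    refine (add_le_add_right h _).trans_eq ?_
    field_simp
    ring

theorem absWalk_shift_le {M y W w d : ℝ} {i l : ℕ} (hw : w ∈ Set.Icc (-1 : ℝ) 1)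
    (hd : ∀ v : ℝ, |v| ≤ (i + 1 : ℕ) → v * y + absWalk M l (W + v) ≤ d) (v : ℝ) (hv : |v| ≤ i) :
    v * y + absWalk M l (W + w + v) ≤ d - w * y := by
  have h := hd (w + v) (by
    push_cast
    linarith [abs_add_le w v, abs_le.2 hw])
  rw [← add_assoc] at h
  linarith

/-- Bound on the value of the game when the player repeats `x` for `j` more rounds and then plays
`k` blocks of `M` rounds each. -/
theorem gameVal1_some_le {K M : ℕ} (hM : 0 < M) (t : ℕ) {j k s : ℕ} {x W c : ℝ}
    (ht : t ≤ j + M * k) (hs : s + k < K) (hx : x ∈ Set.Icc (-1 : ℝ) 1)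
    (h : ∀ v : ℝ, |v| ≤ j → v * x + absWalk M k (W + v) ≤ c) :
    gameVal1 K t (some x) s W ≤ c := by
  induction t generalizing j k s x W c with
  | zero =>
    have h₀ := h 0 (by simp)
    simp only [zero_mul, add_zero, zero_add] at h₀
    exact (abs_le_absWalk _ _ _).trans h₀
  | succ t ih =>
    obtain _ | j := j
    · obtain _ | k := k
      · omega
      obtain ⟨M, rfl⟩ := Nat.exists_eq_succ_of_ne_zero hM.ne'
      obtain ⟨y, hy, hyv⟩ := exists_action_absWalk (M := (M + 1 : ℕ)) (by positivity) k W
      have hinc : switchInc (some x) y ≤ 1 := by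
        simp only [switchInc]
        split_ifs <;> simp
      have h₀ := h 0 (by simp)
      simp only [zero_mul, add_zero, zero_add] at h₀
      refine gameVal1_succ_le y hy (by omega) fun w hw => ?_
      rw [← le_sub_iff_add_le']
      exact ih (j := M) (k := k) (by rw [mul_add] at ht; omega) (by omega) hy
        (absWalk_shift_le hw fun v hv => (hyv v hv).trans h₀)
    · have hinc : switchInc (some x) x = 0 := by simp [switchInc]
      refine gameVal1_succ_le x hx (by omega) fun w hw => ?_
      rw [← le_sub_iff_add_le']
      exact ih (j := j) (k := k) (by omega) (by omega) hx (absWalk_shift_le hw h)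

theorem R1_le_absWalk {T K M : ℕ} (hM : 0 < M) (hK : 1 ≤ K) (hT : T ≤ M * K) :
    R1 T K ≤ absWalk M K 0 := by
  obtain _ | T := T
  · exact abs_le_absWalk _ _ _
  obtain ⟨K, rfl⟩ := Nat.exists_eq_succ_of_ne_zero (by omega : K ≠ 0)
  obtain ⟨x, hx, hxv⟩ := exists_action_absWalk (M := M) (by positivity) K 0
  obtain ⟨M, rfl⟩ := Nat.exists_eq_succ_of_ne_zero hM.ne'
  refine gameVal1_succ_le x hx (by simp [switchInc]) fun w hw => ?_
  rw [← le_sub_iff_add_le']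
  exact gameVal1_some_le (j := M) (k := K) hM T
    (by simp only [Nat.succ_eq_add_one, mul_add] at *; omega) (by simp [switchInc]) hx (absWalk_shift_le hw hxv)

theorem absWalk_mul {M : ℝ} (hM : 0 ≤ M) (k : ℕ) (W : ℝ) :
    absWalk M k (M * W) = M * absWalk 1 k W := by
  induction k generalizing W with
  | zero => simp [absWalk, abs_mul, abs_of_nonneg hM]
  | succ k ih =>
    simp only [absWalk]
    rw [show M * W + M = M * (W + 1) by ring, show M * W - M = M * (W - 1) by ring, ih, ih]
    ring

theorem absWalk_sq_le (M : ℝ) (k : ℕ) (W : ℝ) : absWalk M k W ^ 2 ≤ W ^ 2 + k * M ^ 2 := by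
  induction k generalizing W with
  | zero => simp [absWalk]
  | succ k ih =>
    have h₁ := ih (W + M)
    have h₂ := ih (W - M)
    simp only [absWalk]
    push_cast
    nlinarith [sq_nonneg (absWalk M k (W + M) - absWalk M k (W - M))]

theorem absWalk_succ_eq_of_forall_ne (k : ℕ) (m : ℤ)
    (h : ∀ a b : ℕ, a + b = k → (a : ℤ) - b ≠ m) :
    absWalk 1 (k + 1) m = absWalk 1 k m := by
  induction k generalizing m with
  | zero =>
    have hm : m ≠ 0 := by simpa using (h 0 0 rfl).symm
    simp only [absWalk]
    rcases lt_or_gt_of_ne hm with hm | hm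
    · have hm' : (m : ℝ) ≤ -1 := by exact_mod_cast (by omega : m ≤ -1)
      rw [abs_of_nonpos (by linarith), abs_of_nonpos (by linarith), abs_of_nonpos (by linarith)]
      ring
    · have hm' : (1 : ℝ) ≤ m := by exact_mod_cast hm
      rw [abs_of_nonneg (by linarith), abs_of_nonneg (by linarith), abs_of_nonneg (by linarith)]
      ring
  | succ k ih =>
    have h₁ := ih (m + 1) fun a b hab => by have := h a (b + 1) (by omega); omega
    have h₂ := ih (m - 1) fun a b hab => by have := h (a + 1) b (by omega); omega
    push_cast at h₁ h₂
    rw [absWalk, h₁, h₂, absWalk]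

theorem absWalk_succ_sub (k a b : ℕ) (h : a + b = k) :
    absWalk 1 (k + 1) (a - b) - absWalk 1 k (a - b) = (k.choose a : ℝ) / 2 ^ k := by
  induction k generalizing a b with
  | zero =>
    obtain ⟨rfl, rfl⟩ : a = 0 ∧ b = 0 := by omega
    simp [absWalk]
  | succ k ih =>
    rw [absWalk, absWalk.eq_2 1 (a - b) k]
    obtain _ | a := a
    · obtain rfl : b = k + 1 := by omega
      have h₁ := ih 0 k (by omega)
      have h₂ := absWalk_succ_eq_of_forall_ne k (-(k + 2)) fun a b hab => by omega
      push_cast at h₁ h₂ ⊢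
      rw [show (0 : ℝ) - (k + 1) + 1 = 0 - k by ring,
        show (0 : ℝ) - (k + 1) - 1 = -(k + 2) by ring, h₂, pow_succ]
      simp only [Nat.choose_zero_right, Nat.cast_one] at h₁ ⊢
      rw [← div_div, ← h₁]
      ring
    · obtain _ | b := b
      · obtain rfl : a = k := by omega
        have h₁ := ih a 0 (by omega)
        have h₂ := absWalk_succ_eq_of_forall_ne a (a + 2) fun a b hab => by omega
        push_cast at h₁ h₂ ⊢
        rw [show (a : ℝ) + 1 - 0 - 1 = a - 0 by ring,
          show (a : ℝ) + 1 - 0 + 1 = a + 2 by ring, h₂, pow_succ]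
        simp only [Nat.choose_self, Nat.cast_one] at h₁ ⊢
        rw [← div_div, ← h₁]
        ring
      · have h₁ := ih (a + 1) b (by omega)
        have h₂ := ih a (b + 1) (by omega)
        push_cast [Nat.choose_succ_succ'] at h₁ h₂ ⊢
        rw [show (a : ℝ) + 1 - (b + 1) + 1 = a + 1 - b by ring,
          show (a : ℝ) + 1 - (b + 1) - 1 = a - (b + 1) by ring, pow_succ, ← div_div,
          add_div (k.choose a : ℝ), ← h₁, ← h₂]
        ring

theorem absWalk_two_mul_add_one_eq_add (n : ℕ) :
    absWalk 1 (2 * n + 1) 0 = absWalk 1 (2 * n) 0 + (n.centralBinom : ℝ) / 4 ^ n := by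
  have h := absWalk_succ_sub (2 * n) n n (by omega)
  rw [sub_self, pow_mul, ← Nat.centralBinom_eq_two_mul_choose] at h
  norm_num at h
  linarith

theorem absWalk_two_mul (n : ℕ) :
    absWalk 1 (2 * n) 0 = 2 * n * ((n.centralBinom : ℝ) / 4 ^ n) := by
  induction n with
  | zero => simp [absWalk]
  | succ n ih =>
    have h := absWalk_succ_eq_of_forall_ne (2 * n + 1) 0 fun a b hab => by omega
    have hc : ((n : ℝ) + 1) * (n + 1).centralBinom = 2 * (2 * n + 1) * n.centralBinom := by
      exact_mod_cast Nat.succ_mul_centralBinom_succ n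
    rw [Int.cast_zero] at h
    rw [show 2 * (n + 1) = 2 * n + 1 + 1 by ring, h, absWalk_two_mul_add_one_eq_add, ih]
    push_cast
    rw [pow_succ]
    field_simp
    linear_combination -2 * hc

theorem wallis_W_mul_centralBinom_sq (n : ℕ) :
    Real.Wallis.W n * ((2 * n + 1) * ((n.centralBinom : ℝ) / 4 ^ n) ^ 2) = 1 := by
  induction n with
  | zero => simp [Real.Wallis.W]
  | succ n ih =>
    have hc : (((n + 1).centralBinom : ℝ)) = 2 * (2 * n + 1) * n.centralBinom / (n + 1) := by
      rw [eq_div_iff (by positivity), mul_comm]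
      exact_mod_cast Nat.succ_mul_centralBinom_succ n
    refine Eq.trans ?_ ih
    rw [Real.Wallis.W_succ, hc]
    push_cast
    rw [pow_succ]
    field_simp
    ring

theorem centralBinom_div_four_pow_sq_le (n : ℕ) :
    (2 * n + 1) ^ 2 * ((n.centralBinom : ℝ) / 4 ^ n) ^ 2 ≤ 4 * (n + 1) / Real.pi := by
  have h := mul_le_mul_of_nonneg_right (Real.Wallis.le_W n)
    (by positivity : 0 ≤ (2 * n + 1) * ((n.centralBinom : ℝ) / 4 ^ n) ^ 2)
  rw [wallis_W_mul_centralBinom_sq] at h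
  have hpi := Real.pi_pos
  rw [le_div_iff₀ hpi]
  generalize (n.centralBinom : ℝ) / 4 ^ n = q at *
  field_simp at h
  linarith

theorem absWalk_le_sqrt_pi (k : ℕ) : absWalk 1 k 0 ≤ Real.sqrt (2 * (k + 1) / Real.pi) := by
  apply Real.le_sqrt_of_sq_le
  obtain ⟨n, rfl | rfl⟩ := Nat.even_or_odd' k
  · have h := centralBinom_div_four_pow_sq_le n
    rw [absWalk_two_mul]
    generalize (n.centralBinom : ℝ) / 4 ^ n = q at *
    have hpi := Real.pi_pos
    rw [le_div_iff₀ hpi] at h ⊢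
    push_cast
    have hn : (0 : ℝ) ≤ n := n.cast_nonneg
    have hmul := mul_le_mul_of_nonneg_left h (by positivity : (0 : ℝ) ≤ 4 * n ^ 2)
    have hpos : (0 : ℝ) < (2 * n + 1) ^ 2 := by positivity
    refine le_of_mul_le_mul_left ?_ hpos
    nlinarith [pow_nonneg hn 2]
  · refine le_trans (le_of_eq ?_) ((centralBinom_div_four_pow_sq_le n).trans (le_of_eq ?_))
    · rw [absWalk_two_mul_add_one_eq_add, absWalk_two_mul]
      ring
    · push_cast
      ring

theorem absWalk_le_sqrt (k : ℕ) : absWalk 1 k 0 ≤ Real.sqrt k := by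
  apply Real.le_sqrt_of_sq_le
  simpa using absWalk_sq_le 1 k 0

/-- For all integers `T ≥ K ≥ 1`, the minimax regret of one-dimensional
switching-constrained online linear optimization satisfies
`R₁(T,K) ≤ ⌈T/K⌉ · min{√(2(K+1)/π), √K} ≤ 2√(2/π) · T/√K`. -/
theorem stmt3 (T K : ℕ) (hK : 1 ≤ K) (hTK : K ≤ T) :
    R1 T K ≤ (⌈(T : ℝ) / (K : ℝ)⌉ : ℝ) *
        min (Real.sqrt (2 * (K + 1) / Real.pi)) (Real.sqrt K) ∧
    (⌈(T : ℝ) / (K : ℝ)⌉ : ℝ) *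
        min (Real.sqrt (2 * (K + 1) / Real.pi)) (Real.sqrt K) ≤
      2 * Real.sqrt (2 / Real.pi) * (T : ℝ) / Real.sqrt K := by
  have hK' : (0 : ℝ) < K := by exact_mod_cast hK
  have hT' : (0 : ℝ) < T := by exact_mod_cast (by omega : 0 < T)
  rw [← natCast_ceil_eq_intCast_ceil (by positivity : 0 ≤ (T : ℝ) / K)]
  have hM : 0 < ⌈(T : ℝ) / K⌉₊ := Nat.ceil_pos.2 (by positivity)
  have hle : T ≤ ⌈(T : ℝ) / K⌉₊ * K := by
    have h := Nat.le_ceil ((T : ℝ) / K)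
    rw [div_le_iff₀ hK'] at h
    exact_mod_cast h
  have hlt : ⌈(T : ℝ) / K⌉₊ * K + 1 ≤ T + K := by
    have h := Nat.ceil_lt_add_one (by positivity : 0 ≤ (T : ℝ) / K)
    rw [← sub_lt_iff_lt_add, lt_div_iff₀ hK', sub_mul, one_mul, sub_lt_iff_lt_add] at h
    exact_mod_cast h
  generalize ⌈(T : ℝ) / K⌉₊ = M at *
  constructor
  · refine (R1_le_absWalk hM hK hle).trans ?_
    have h := absWalk_mul (Nat.cast_nonneg (α := ℝ) M) K 0
    rw [mul_zero] at h
    rw [h]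
    exact mul_le_mul_of_nonneg_left (le_min (absWalk_le_sqrt_pi K) (absWalk_le_sqrt K))
      M.cast_nonneg
  · refine (mul_le_mul_of_nonneg_left (min_le_left _ _) M.cast_nonneg).trans ?_
    have hlt' : (M : ℝ) * K + 1 ≤ T + K := by exact_mod_cast hlt
    have hTK' : (K : ℝ) ≤ T := by exact_mod_cast hTK
    have hK₁ : (1 : ℝ) ≤ K := by exact_mod_cast hK
    rw [show 2 * ((K : ℝ) + 1) / Real.pi = 2 / Real.pi * (K + 1) by ring,
      Real.sqrt_mul (by positivity), le_div_iff₀ (by positivity)]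
    have key : (M : ℝ) * (Real.sqrt (K + 1) * Real.sqrt K) ≤ 2 * T := by
      rw [← Real.sqrt_mul (by positivity)]
      have hsqrt : Real.sqrt ((K + 1) * K) ≤ K + 1 / 2 :=
        Real.sqrt_le_iff.2 ⟨by positivity, by nlinarith⟩
      refine (mul_le_mul_of_nonneg_left hsqrt M.cast_nonneg).trans ?_
      refine le_of_mul_le_mul_left ?_ hK'
      nlinarith
    have := mul_le_mul_of_nonneg_left key (Real.sqrt_nonneg (2 / Real.pi))
    linarith
end
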